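/- Let g and ḡ be projectively equivalent metrics on U. Then for every t ∈ ℝ the tensor K^{(t)}(x) := g(x)·S(t)(x) is a Killing tensor for g; that is, for every g-geodesic γ the function τ ↦ γ'(τ)ᵀ g(γ(τ)) S(t)(γ(τ)) γ'(τ) is constant. -/

import Mathlib

open Matrix

noncomputable section

/-- Partial derivative in the `i`-th coordinate direction of a real-valued function on `ℝⁿ`. -/
def pd {n : ℕ} (i : Fin n) (f : (Fin n → ℝ) → ℝ) : (Fin n → ℝ) → ℝ :=
  fun x => fderiv ℝ f x (Pi.single i 1)

/-- Iterated partial derivatives along a list of coordinate directions. -/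
def iterPD {n : ℕ} : List (Fin n) → ((Fin n → ℝ) → ℝ) → ((Fin n → ℝ) → ℝ)
  | [], f => f
  | i :: l, f => pd i (iterPD l f)

/-- `g` is a (pseudo-Riemannian) metric on `U`: a smooth field of invertible symmetric
real `n×n` matrices. -/
structure IsMetricOn {n : ℕ} (U : Set (Fin n → ℝ))
    (g : (Fin n → ℝ) → Matrix (Fin n) (Fin n) ℝ) : Prop where
  smooth : ∀ i j : Fin n, ContDiffOn ℝ (⊤ : ℕ∞) (fun x => g x i j) U
  symm : ∀ x ∈ U, (g x).IsSymm
  nondeg : ∀ x ∈ U, IsUnit (g x).det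

/-- The Christoffel symbols `Γ^k_{ij}` of the metric `g`. -/
def Gamma {n : ℕ} (g : (Fin n → ℝ) → Matrix (Fin n) (Fin n) ℝ)
    (k i j : Fin n) (x : Fin n → ℝ) : ℝ :=
  (1/2) * ∑ ℓ, (g x)⁻¹ k ℓ *
    (pd i (fun y => g y ℓ j) x + pd j (fun y => g y ℓ i) x - pd ℓ (fun y => g y i j) x)

/-- An open interval of `ℝ` (possibly empty or unbounded): an open order-connected set. -/
def IsOpenInterval (I : Set ℝ) : Prop := IsOpen I ∧ I.OrdConnected

/-- `γ` is a `g`-geodesic defined on the open interval `I`, with values in `U`. -/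
structure IsGeodesicOn {n : ℕ} (U : Set (Fin n → ℝ))
    (g : (Fin n → ℝ) → Matrix (Fin n) (Fin n) ℝ)
    (γ : ℝ → (Fin n → ℝ)) (I : Set ℝ) : Prop where
  interval : IsOpenInterval I
  smooth : ∀ k : Fin n, ContDiffOn ℝ (⊤ : ℕ∞) (fun s => γ s k) I
  mem : ∀ t ∈ I, γ t ∈ U
  eqn : ∀ t ∈ I, ∀ k : Fin n,
    deriv (deriv fun s => γ s k) t
      + ∑ i, ∑ j, Gamma g k i j (γ t) * deriv (fun s => γ s i) t * deriv (fun s => γ s j) t = 0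

/-- `g` and `gbar` are projectively equivalent on `U`: every `g`-geodesic with nowhere
vanishing velocity becomes, after a smooth reparameterization (a diffeomorphism of open
intervals), a `gbar`-geodesic. -/
def ProjEquiv {n : ℕ} (U : Set (Fin n → ℝ))
    (g gbar : (Fin n → ℝ) → Matrix (Fin n) (Fin n) ℝ) : Prop :=
  ∀ (γ : ℝ → (Fin n → ℝ)) (I : Set ℝ), IsGeodesicOn U g γ I →
    (∀ t ∈ I, ∃ k, deriv (fun s => γ s k) t ≠ 0) →
    ∃ (φ : ℝ → ℝ) (J : Set ℝ), IsOpenInterval J ∧ ContDiffOn ℝ (⊤ : ℕ∞) φ J ∧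
      Set.InjOn φ J ∧ φ '' J = I ∧ (∀ t ∈ J, deriv φ t ≠ 0) ∧
      IsGeodesicOn U gbar (γ ∘ φ) J

/-- The (1,1)-tensor `L = |det gbar / det g|^{1/(n+1)} gbar⁻¹ g` built from `g` and `gbar`. -/
def Lfield {n : ℕ} (g gbar : (Fin n → ℝ) → Matrix (Fin n) (Fin n) ℝ)
    (x : Fin n → ℝ) : Matrix (Fin n) (Fin n) ℝ :=
  |(gbar x).det / (g x).det| ^ ((1 : ℝ)/((n : ℝ)+1)) • ((gbar x)⁻¹ * g x)

/-- The family `S(t) = adjugate (t·Id − L)`. -/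
def Sfield {n : ℕ} (g gbar : (Fin n → ℝ) → Matrix (Fin n) (Fin n) ℝ) (t : ℝ)
    (x : Fin n → ℝ) : Matrix (Fin n) (Fin n) ℝ :=
  (t • (1 : Matrix (Fin n) (Fin n) ℝ) - Lfield g gbar x).adjugate

/-- The second order operator associated (via Carter's quantization) to a field `A` of
symmetric matrices: `Â f = |det g|^{-1/2} ∑ᵢⱼ ∂ᵢ(|det g|^{1/2} Aⁱʲ ∂ⱼ f)`. -/
def assocOp {n : ℕ} (g A : (Fin n → ℝ) → Matrix (Fin n) (Fin n) ℝ)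
    (f : (Fin n → ℝ) → ℝ) (x : Fin n → ℝ) : ℝ :=
  |(g x).det| ^ (-(1 : ℝ)/2) * ∑ i, ∑ j,
    pd i (fun y => |(g y).det| ^ ((1 : ℝ)/2) * A y i j * pd j f y) x

/-- The operator `K̂^{(t)}`, associated to `A = S(t)·g⁻¹`. -/
def Khat {n : ℕ} (g gbar : (Fin n → ℝ) → Matrix (Fin n) (Fin n) ℝ) (t : ℝ)
    (f : (Fin n → ℝ) → ℝ) (x : Fin n → ℝ) : ℝ :=
  assocOp g (fun y => Sfield g gbar t y * (g y)⁻¹) f x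

/-- The Beltrami-Laplace operator of `g`, associated to `A = g⁻¹`. -/
def LaplaceOp {n : ℕ} (g : (Fin n → ℝ) → Matrix (Fin n) (Fin n) ℝ)
    (f : (Fin n → ℝ) → ℝ) (x : Fin n → ℝ) : ℝ :=
  assocOp g (fun y => (g y)⁻¹) f x

/-- `K` is a Killing tensor for `g` on `U`: the associated quadratic function is constant
along every `g`-geodesic. -/
def IsKillingTensorOn {n : ℕ} (U : Set (Fin n → ℝ))
    (g K : (Fin n → ℝ) → Matrix (Fin n) (Fin n) ℝ) : Prop :=
  ∀ (γ : ℝ → (Fin n → ℝ)) (I : Set ℝ), IsGeodesicOn U g γ I →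
    ∀ τ₁ ∈ I, ∀ τ₂ ∈ I,
      (∑ i, ∑ j, deriv (fun s => γ s i) τ₁ * K (γ τ₁) i j * deriv (fun s => γ s j) τ₁) =
      (∑ i, ∑ j, deriv (fun s => γ s i) τ₂ * K (γ τ₂) i j * deriv (fun s => γ s j) τ₂)

/-- The covariant derivative `∇_k T_{ij}` of a (0,2)-tensor field `T`. -/
def covDeriv2 {n : ℕ} (g T : (Fin n → ℝ) → Matrix (Fin n) (Fin n) ℝ)
    (k i j : Fin n) (x : Fin n → ℝ) : ℝ :=
  pd k (fun y => T y i j) x - (∑ s, Gamma g s k i x * T x s j)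
    - ∑ s, Gamma g s k j x * T x i s

/-- The Ricci curvature tensor `R_{ij}` of `g`. -/
def Ricci {n : ℕ} (g : (Fin n → ℝ) → Matrix (Fin n) (Fin n) ℝ)
    (i j : Fin n) (x : Fin n → ℝ) : ℝ :=
  (∑ ℓ, pd ℓ (fun y => Gamma g ℓ i j y) x) - (∑ ℓ, pd i (fun y => Gamma g ℓ ℓ j y) x)
    + ∑ ℓ, ∑ s, (Gamma g ℓ ℓ s x * Gamma g s i j x - Gamma g ℓ i s x * Gamma g s ℓ j x)

/-- A function vanishes up to order `k` at `p`: it and all its partial derivatives of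
order `≤ k` vanish at `p`. -/
def VanishUpTo {n : ℕ} (k : ℕ) (f : (Fin n → ℝ) → ℝ) (p : Fin n → ℝ) : Prop :=
  ∀ l : List (Fin n), l.length ≤ k → iterPD l f p = 0


/-- The plain (flat) second order operator `Â f = ∑ᵢⱼ ∂ᵢ(Aⁱʲ ∂ⱼ f)` associated to a
matrix field `A`. -/
def opPlain {n : ℕ} (A : (Fin n → ℝ) → Matrix (Fin n) (Fin n) ℝ)
    (f : (Fin n → ℝ) → ℝ) (x : Fin n → ℝ) : ℝ :=
  ∑ i, ∑ j, pd i (fun y => A y i j * pd j f y) x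

end

section MatrixCurves

open scoped Matrix.Norms.Operator

variable {ι : Type*} [Fintype ι]

theorem contDiff_matrix_entry {k : WithTop ℕ∞} (i j : ι) :
    ContDiff ℝ k (fun A : Matrix ι ι ℝ => A i j) :=
  (Matrix.entryLinearMap ℝ ℝ i j).toContinuousLinearMap.contDiff

variable [DecidableEq ι]

/-- A curve of matrices is differentiable iff all its entries are. -/
theorem hasDerivAt_matrix_iff {A : ℝ → Matrix ι ι ℝ} {A' : Matrix ι ι ℝ} {s : ℝ} :
    HasDerivAt A A' s ↔ ∀ i j, HasDerivAt (fun r => A r i j) (A' i j) s := by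
  constructor
  · intro h i j
    exact ((Matrix.entryLinearMap ℝ ℝ i j).toContinuousLinearMap.hasFDerivAt.comp_hasDerivAt s h)
  · intro h
    have key : ∀ B : Matrix ι ι ℝ, B = ∑ i, ∑ j, B i j • Matrix.single i j (1 : ℝ) := fun B => by
      simpa using Matrix.matrix_eq_sum_single B
    rw [show A = fun r => ∑ i, ∑ j, A r i j • Matrix.single i j (1 : ℝ) from
      funext fun r => key _, key A']
    exact HasDerivAt.fun_sum fun i _ => HasDerivAt.fun_sum fun j _ => (h i j).smul_const _

theorem contDiff_matrix_det {k : WithTop ℕ∞} : ContDiff ℝ k (fun A : Matrix ι ι ℝ => A.det) := by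
  simp only [Matrix.det_apply']
  exact ContDiff.sum fun σ _ => contDiff_const.mul
    (contDiff_prod fun i _ => contDiff_matrix_entry _ _)

theorem contDiff_matrix_iff {k : WithTop ℕ∞} {E : Type*} [NormedAddCommGroup E] [NormedSpace ℝ E]
    {f : E → Matrix ι ι ℝ} :
    ContDiff ℝ k f ↔ ∀ i j, ContDiff ℝ k (fun x => f x i j) := by
  refine ⟨fun h i j => (contDiff_matrix_entry i j).comp h, fun h => ?_⟩
  rw [show f = fun x => ∑ i, ∑ j, f x i j • Matrix.single i j (1 : ℝ) from
    funext fun x => by simpa using Matrix.matrix_eq_sum_single (f x)]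
  exact ContDiff.sum fun i _ => ContDiff.sum fun j _ => (h i j).smul contDiff_const

theorem contDiff_matrix_adjugate {k : WithTop ℕ∞} :
    ContDiff ℝ k (fun A : Matrix ι ι ℝ => A.adjugate) := by
  refine contDiff_matrix_iff.2 fun i j => ?_
  simp only [Matrix.adjugate_apply]
  refine contDiff_matrix_det.comp (contDiff_matrix_iff.2 fun p q => ?_)
  simp only [Matrix.updateRow_apply]
  split_ifs
  · exact contDiff_const
  · exact contDiff_matrix_entry p q

/-- Jacobi's formula for the derivative of the determinant. -/
theorem hasDerivAt_matrix_det {A : ℝ → Matrix ι ι ℝ} {A' : Matrix ι ι ℝ} {s : ℝ}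
    (h : HasDerivAt A A' s) :
    HasDerivAt (fun r => (A r).det) ((A s).adjugate * A').trace s := by
  let D : ContinuousMultilinearMap ℝ (fun _ : ι => ι → ℝ) ℝ :=
    { (Matrix.detRowAlternating (n := ι) (R := ℝ)).toMultilinearMap with
      cont := by
        exact (continuous_id (X := Matrix ι ι ℝ)).matrix_det }
  have hpi : HasDerivAt (fun r i => A r i) (fun i => A' i) s :=
    hasDerivAt_pi.2 fun i => hasDerivAt_pi.2 fun j => hasDerivAt_matrix_iff.1 h i j
  have := (D.hasFDerivAt (fun i => A s i)).comp_hasDerivAt s hpi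
  refine this.congr_deriv ?_
  rw [ContinuousMultilinearMap.linearDeriv_apply]
  have : ∀ i, D (Function.update (fun i => A s i) i (A' i)) = ∑ j, A' i j * (A s).adjugate j i := by
    intro i
    change ((A s).updateRow i (A' i)).det = _
    rw [Matrix.det_eq_sum_mul_adjugate_row _ i]
    simp [Matrix.adjugate_apply]
  simp only [this]
  rw [Matrix.trace_mul_comm]
  simp [Matrix.trace, Matrix.mul_apply]

theorem hasDerivAt_matrix_inv {A : ℝ → Matrix ι ι ℝ} {A' : Matrix ι ι ℝ} {s : ℝ}
    (h : HasDerivAt A A' s) (hs : IsUnit (A s).det) :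
    HasDerivAt (fun r => (A r)⁻¹) (-((A s)⁻¹ * A' * (A s)⁻¹)) s := by
  obtain ⟨u, hu⟩ := (Matrix.isUnit_iff_isUnit_det _).2 hs
  have hinv := hasFDerivAt_ringInverse (𝕜 := ℝ) u
  rw [hu] at hinv
  have := hinv.comp_hasDerivAt s h
  simp only [Matrix.nonsing_inv_eq_ringInverse]
  refine this.congr_deriv ?_
  have hu' : (↑u⁻¹ : Matrix ι ι ℝ) = Ring.inverse (A s) := by rw [← hu, Ring.inverse_unit]
  simp [hu']

theorem hasDerivAt_bilinear {a v : ℝ → ι → ℝ} {B : ℝ → Matrix ι ι ℝ} {a' v' : ι → ℝ}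
    {B' : Matrix ι ι ℝ} {s : ℝ} (ha : HasDerivAt a a' s) (hB : HasDerivAt B B' s)
    (hv : HasDerivAt v v' s) :
    HasDerivAt (fun r => a r ⬝ᵥ B r *ᵥ v r)
      (a' ⬝ᵥ B s *ᵥ v s + a s ⬝ᵥ B' *ᵥ v s + a s ⬝ᵥ B s *ᵥ v') s := by
  have h1 := fun i j => ((hasDerivAt_pi.1 ha i).mul
    ((hasDerivAt_matrix_iff.1 hB i j).mul (hasDerivAt_pi.1 hv j)))
  have h2 := HasDerivAt.fun_sum (u := Finset.univ) fun i _ =>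
    HasDerivAt.fun_sum (u := Finset.univ) fun j _ => h1 i j
  simp only [dotProduct, Matrix.mulVec, Finset.mul_sum]
  refine h2.congr_deriv ?_
  simp only [← Finset.sum_add_distrib]
  exact Finset.sum_congr rfl fun i _ => Finset.sum_congr rfl fun j _ => by
    simp only [Pi.mul_apply]
    ring

/-- If `A` is parallel for the connection matrix `C` up to rank one terms built from `v` and `a`,
and is invertible at `s`, then the quadratic form `a ⬝ adj(A) v` is stationary at `s`. -/
theorem hasDerivAt_adjugate_form_of_isUnit {a v : ℝ → ι → ℝ} {A : ℝ → Matrix ι ι ℝ} {s : ℝ}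
    {C : Matrix ι ι ℝ} {b m : ι → ℝ}
    (ha : HasDerivAt a (a s ᵥ* C) s) (hv : HasDerivAt v (-(C *ᵥ v s)) s)
    (hA : HasDerivAt A (A s * C - C * A s + vecMulVec (v s) b + vecMulVec m (a s)) s)
    (hu : IsUnit (A s).det) :
    HasDerivAt (fun r => a r ⬝ᵥ (A r).adjugate *ᵥ v r) 0 s := by
  have hcont : ContinuousAt (fun r => (A r).det) s := (hasDerivAt_matrix_det hA).continuousAt
  have hev : ∀ᶠ r in nhds s, (A r).adjugate = (A r).det • (A r)⁻¹ := by
    filter_upwards [hcont.eventually_ne hu.ne_zero] with r hr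
    rw [Matrix.inv_def, smul_smul, Ring.mul_inverse_cancel _ (isUnit_iff_ne_zero.2 hr), one_smul]
  have hadj := ((hasDerivAt_matrix_det hA).smul (hasDerivAt_matrix_inv hA hu)).congr_of_eventuallyEq
    hev
  refine (hasDerivAt_bilinear ha hadj hv).congr_deriv ?_
  rw [hev.self_of_nhds]
  set M := (A s)⁻¹ with hM
  have hAM : A s * M = 1 := Matrix.mul_nonsing_inv _ hu
  have hMA : M * A s = 1 := Matrix.nonsing_inv_mul _ hu
  have e1 : M * (A s * C - C * A s + vecMulVec (v s) b + vecMulVec m (a s)) * M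
      = C * M - M * C + vecMulVec (M *ᵥ v s) (b ᵥ* M) + vecMulVec (M *ᵥ m) (a s ᵥ* M) := by
    have h1 : M * (A s * C) * M = C * M := by rw [← mul_assoc M, hMA, one_mul]
    have h2 : M * (C * A s) * M = M * C := by rw [mul_assoc, mul_assoc, hAM, mul_one]
    rw [mul_add, mul_add, mul_sub, add_mul, add_mul, sub_mul, h1, h2]
    simp only [Matrix.mul_vecMulVec, Matrix.vecMulVec_mul]
  have e2 : (M * (A s * C - C * A s + vecMulVec (v s) b + vecMulVec m (a s))).trace
      = b ⬝ᵥ M *ᵥ v s + a s ⬝ᵥ M *ᵥ m := by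
    have h1 : (M * (A s * C)).trace = C.trace := by rw [← mul_assoc M, hMA, one_mul]
    have h2 : (M * (C * A s)).trace = C.trace := by
      rw [Matrix.trace_mul_comm, mul_assoc, hAM, mul_one]
    rw [mul_add, mul_add, mul_sub, Matrix.trace_add, Matrix.trace_add, Matrix.trace_sub, h1, h2]
    simp [Matrix.mul_vecMulVec, Matrix.trace_vecMulVec, dotProduct_comm]
  have e3 : (A s).adjugate = (A s).det • M := hev.self_of_nhds
  rw [e1, Matrix.smul_mul, Matrix.trace_smul, e2]
  simp only [Matrix.add_mulVec, Matrix.smul_mulVec, Matrix.neg_mulVec, Matrix.sub_mulVec,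
    Matrix.vecMulVec_mulVec, dotProduct_add, dotProduct_smul, dotProduct_neg, dotProduct_sub,
    Matrix.mulVec_neg, ← Matrix.mulVec_mulVec, ← Matrix.dotProduct_mulVec, smul_eq_mul]
  simp
  ring

/-- Version of `hasDerivAt_adjugate_form_of_isUnit` for `t • 1 - L`, without invertibility: the
derivative is continuous in `t` and vanishes for all but finitely many `t`. -/
theorem hasDerivAt_adjugate_form {a v : ℝ → ι → ℝ} {L : ℝ → Matrix ι ι ℝ} {s : ℝ}
    {C : Matrix ι ι ℝ} {b m : ι → ℝ}
    (ha : HasDerivAt a (a s ᵥ* C) s) (hv : HasDerivAt v (-(C *ᵥ v s)) s)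
    (hL : HasDerivAt L (L s * C - C * L s - vecMulVec (v s) b - vecMulVec m (a s)) s) (t : ℝ) :
    HasDerivAt (fun r => a r ⬝ᵥ (t • (1 : Matrix ι ι ℝ) - L r).adjugate *ᵥ v r) 0 s := by
  set L' := L s * C - C * L s - vecMulVec (v s) b - vecMulVec m (a s) with hL'
  have hA : ∀ t : ℝ, HasDerivAt (fun r => t • (1 : Matrix ι ι ℝ) - L r) (-L') s := fun t =>
    hL.const_sub _
  have hcd := contDiff_matrix_adjugate (ι := ι) (k := 1)
  let D : ℝ → Matrix ι ι ℝ := fun t =>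
    fderiv ℝ (fun A : Matrix ι ι ℝ => A.adjugate) (t • 1 - L s) (-L')
  let F : ℝ → ℝ := fun t =>
    (a s ᵥ* C) ⬝ᵥ (t • (1 : Matrix ι ι ℝ) - L s).adjugate *ᵥ v s + a s ⬝ᵥ D t *ᵥ v s
      + a s ⬝ᵥ (t • (1 : Matrix ι ι ℝ) - L s).adjugate *ᵥ (-(C *ᵥ v s))
  have hF : ∀ t, HasDerivAt (fun r => a r ⬝ᵥ (t • (1 : Matrix ι ι ℝ) - L r).adjugate *ᵥ v r)
      (F t) s := fun t =>
    hasDerivAt_bilinear ha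
      (((hcd.differentiable one_ne_zero _).hasFDerivAt).comp_hasDerivAt s (hA t)) hv
  have hline : Continuous fun t : ℝ => t • (1 : Matrix ι ι ℝ) - L s := by fun_prop
  have hD : Continuous D :=
    ((hcd.continuous_fderiv one_ne_zero).comp hline).clm_apply continuous_const
  have hFc : Continuous F := by
    refine ((continuous_const.dotProduct (hline.matrix_adjugate.matrix_mulVec
      continuous_const)).add (continuous_const.dotProduct (hD.matrix_mulVec
      continuous_const))).add (continuous_const.dotProduct (hline.matrix_adjugate.matrix_mulVec
      continuous_const))
  have hgen : ∀ t, (L s).charpoly.eval t ≠ 0 → F t = 0 := by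
    intro t ht
    refine (hF t).unique (hasDerivAt_adjugate_form_of_isUnit (b := b) (m := m) ha hv
      ((hA t).congr_deriv ?_) ?_)
    · rw [hL', sub_mul, mul_sub]
      simp
      abel
    · rw [isUnit_iff_ne_zero]
      rw [Matrix.eval_charpoly] at ht
      convert ht using 2
      rw [Matrix.smul_one_eq_diagonal]
      rfl
  have hdense : Dense {t | (L s).charpoly.eval t ≠ 0} := by
    have hfin : {t | (L s).charpoly.eval t = 0}.Finite := by
      refine ((L s).charpoly.roots.toFinset.finite_toSet).subset fun t ht => ?_
      simpa [Polynomial.mem_roots (L s).charpoly_monic.ne_zero] using ht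
    exact hfin.countable.dense_compl ℝ
  have hF0 : F = 0 := hFc.ext_on hdense continuous_const hgen
  exact (hF t).congr_deriv (congrFun hF0 t)

end MatrixCurves

section ProjectiveChange

open scoped Matrix.Norms.Operator

variable {n : ℕ}

/-- If a curve of metrics `G` is parallel with respect to the connection matrix `C` and `H` is
parallel with respect to a projectively changed connection matrix, then the normalised
endomorphism `|det H / det G|^{1/(n+1)} H⁻¹ G` is parallel up to two rank one terms. -/
theorem hasDerivAt_normalized_inv_mul {G H : ℝ → Matrix (Fin n) (Fin n) ℝ} {s : ℝ}
    {C : Matrix (Fin n) (Fin n) ℝ} {v φ : Fin n → ℝ} {L : ℝ → Matrix (Fin n) (Fin n) ℝ}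
    (hL : ∀ r, L r = |(H r).det / (G r).det| ^ ((1 : ℝ) / ((n : ℝ) + 1)) • ((H r)⁻¹ * G r))
    (hG : HasDerivAt G (Cᵀ * G s + G s * C) s)
    (hH : HasDerivAt H ((C + vecMulVec v φ + (φ ⬝ᵥ v) • 1)ᵀ * H s
      + H s * (C + vecMulVec v φ + (φ ⬝ᵥ v) • 1)) s)
    (hGu : IsUnit (G s).det) (hHu : IsUnit (H s).det) :
    HasDerivAt L (L s * C - C * L s - vecMulVec v (φ ᵥ* L s)
      - vecMulVec (|(H s).det / (G s).det| ^ ((1 : ℝ) / ((n : ℝ) + 1)) • ((H s)⁻¹ *ᵥ φ))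
        (v ᵥ* G s)) s := by
  set c := φ ⬝ᵥ v with hc
  set E := C + vecMulVec v φ + c • (1 : Matrix (Fin n) (Fin n) ℝ) with hE
  have htr : ∀ (P D : Matrix (Fin n) (Fin n) ℝ),
      (P.adjugate * (Dᵀ * P + P * D)).trace = P.det * (2 * D.trace) := by
    intro P D
    rw [mul_add, Matrix.trace_add, Matrix.trace_mul_comm, mul_assoc, Matrix.mul_adjugate,
      ← mul_assoc, Matrix.adjugate_mul]
    simp
    ring
  have hEtr : E.trace = C.trace + (n + 1) * c := by
    simp [hE, Matrix.trace_vecMulVec, hc, dotProduct_comm]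
    ring
  have hdG := hasDerivAt_matrix_det hG
  have hdH := hasDerivAt_matrix_det hH
  rw [htr] at hdG hdH
  have hGne := hGu.ne_zero
  have hHne := hHu.ne_zero
  have hn : (n : ℝ) + 1 ≠ 0 := by positivity
  set q := (H s).det / (G s).det with hq
  have hqne : q ≠ 0 := div_ne_zero hHne hGne
  have hquot : HasDerivAt (fun r => (H r).det / (G r).det) (q * (2 * (n + 1) * c)) s := by
    refine (hdH.fun_div hdG hGne).congr_deriv ?_
    rw [hEtr, hq]
    field_simp
    ring
  have habs : HasDerivAt (fun r => |(H r).det / (G r).det|) (|q| * (2 * (n + 1) * c)) s := by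
    refine ((hasDerivAt_abs hqne).comp s hquot).congr_deriv ?_
    rw [← mul_assoc]
    congr 1
    exact _root_.sign_mul_self q
  have hf : HasDerivAt (fun r => |(H r).det / (G r).det| ^ ((1 : ℝ) / ((n : ℝ) + 1)))
      (2 * c * |q| ^ ((1 : ℝ) / ((n : ℝ) + 1))) s := by
    have hqa : |q| ≠ 0 := abs_ne_zero.2 hqne
    refine (habs.rpow_const (Or.inl hqa)).congr_deriv ?_
    rw [← hq, Real.rpow_sub_one hqa]
    field_simp
  rw [show L = _ from funext hL]
  refine (hf.smul ((hasDerivAt_matrix_inv hH hHu).mul hG)).congr_deriv ?_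
  simp only [← hq, Pi.mul_apply]
  set f := |q| ^ ((1 : ℝ) / ((n : ℝ) + 1))
  set P := (H s)⁻¹
  have hPH : P * H s = 1 := Matrix.nonsing_inv_mul _ hHu
  have hHP : H s * P = 1 := Matrix.mul_nonsing_inv _ hHu
  have e1 : P * (Eᵀ * H s + H s * E) * P = P * Eᵀ + E * P := by
    rw [mul_add, add_mul, ← mul_assoc P (H s), hPH, one_mul, ← mul_assoc P, mul_assoc _ (H s), hHP,
      mul_one]
  have e2 : Eᵀ = Cᵀ + vecMulVec φ v + c • (1 : Matrix (Fin n) (Fin n) ℝ) := by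
    simp [hE, Matrix.transpose_vecMulVec]
  rw [e1, e2, hE]
  have e3 : vecMulVec (f • (P *ᵥ φ)) (v ᵥ* G s) = f • (P * vecMulVec φ v * G s) := by
    rw [Matrix.mul_vecMulVec, Matrix.vecMulVec_mul, Matrix.smul_vecMulVec]
  have e4 : vecMulVec v (φ ᵥ* (f • (P * G s))) = f • (vecMulVec v φ * P * G s) := by
    rw [mul_assoc, Matrix.vecMulVec_mul, Matrix.vecMul_smul, Matrix.vecMulVec_smul]
  rw [e3, e4]
  simp only [mul_add, add_mul, neg_mul, mul_smul_comm, smul_mul_assoc, mul_one, one_mul, neg_add,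
    mul_assoc, smul_add, smul_neg]
  module

/-- A symmetric bilinear vector-valued map whose quadratic form is everywhere proportional to the
argument is of the form `(u, v) ↦ φ(u) v + φ(v) u`. -/
theorem exists_covector_of_quadratic_proportional {T : Fin n → Fin n → Fin n → ℝ}
    (hsymm : ∀ k i j, T k i j = T k j i)
    (hT : ∀ v : Fin n → ℝ, ∃ c : ℝ, ∀ k, ∑ i, ∑ j, T k i j * v i * v j = c * v k) :
    ∃ φ : Fin n → ℝ, ∀ k i j,
      T k i j = (if k = i then φ j else 0) + (if k = j then φ i else 0) := by
  have hdiag : ∀ k i, k ≠ i → T k i i = 0 := by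
    intro k i hki
    obtain ⟨c, hc⟩ := hT (Pi.single i 1)
    have := hc k
    simpa [Pi.single_apply, hki] using this
  have hoff : ∀ (e : ℝ) (i j : Fin n), i ≠ j → ∃ c : ℝ, ∀ k,
      T k i i + 2 * e * T k i j + e ^ 2 * T k j j
        = c * ((if k = i then 1 else 0) + e * if k = j then 1 else 0) := by
    intro e i j hij
    obtain ⟨c, hc⟩ := hT (Pi.single i 1 + e • Pi.single j 1)
    refine ⟨c, fun k => ?_⟩
    have := hc k
    simp only [Pi.add_apply, Pi.smul_apply, Pi.single_apply, smul_eq_mul, mul_add, add_mul,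
      Finset.sum_add_distrib] at this
    simp at this
    rw [hsymm k j i] at this
    rw [mul_add]
    split_ifs at this ⊢ <;> linarith
  refine ⟨fun i => T i i i / 2, fun k i j => ?_⟩
  by_cases hij : i = j
  · subst hij
    by_cases hki : k = i
    · subst hki; simp
    · simp [hki, hdiag k i hki]
  obtain ⟨c, hc⟩ := hoff 1 i j hij
  obtain ⟨d, hd⟩ := hoff (-1) i j hij
  have hji : ¬ j = i := fun h => hij h.symm
  have h1 := hc k
  have h2 := hd k
  have h3 := hc i
  have h4 := hd i
  have h5 := hc j
  have h6 := hd j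
  simp [hij, hji, hdiag i j hij, hdiag j i hji] at h3 h4 h5 h6
  by_cases hki : k = i
  · subst hki
    simp [hij]
    linarith
  by_cases hkj : k = j
  · subst hkj
    simp [hki]
    linarith
  simp [hki, hkj, hdiag k i hki, hdiag k j hkj] at h1
  simp [hki, hkj, h1]

end ProjectiveChange

section MetricAlongCurve

open scoped Matrix.Norms.Operator

variable {n : ℕ} {U : Set (Fin n → ℝ)} {g : (Fin n → ℝ) → Matrix (Fin n) (Fin n) ℝ}

theorem pd_metric_symm (hUo : IsOpen U) (hg : IsMetricOn U g) {x : Fin n → ℝ} (hx : x ∈ U)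
    (k i j : Fin n) : pd k (fun y => g y i j) x = pd k (fun y => g y j i) x := by
  have : (fun y => g y i j) =ᶠ[nhds x] fun y => g y j i := by
    filter_upwards [hUo.mem_nhds hx] with y hy
    exact (hg.symm y hy).apply j i
  simp only [pd, this.fderiv_eq]

theorem Gamma_symm (hUo : IsOpen U) (hg : IsMetricOn U g) {x : Fin n → ℝ} (hx : x ∈ U)
    (k i j : Fin n) : Gamma g k i j x = Gamma g k j i x := by
  simp only [Gamma, pd_metric_symm hUo hg hx _ i j]
  congr 1
  exact Finset.sum_congr rfl fun l _ => by ring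

/-- Christoffel symbols of the first kind. -/
theorem sum_metric_mul_Gamma (hg : IsMetricOn U g) {x : Fin n → ℝ} (hx : x ∈ U)
    (i k j : Fin n) :
    ∑ l, g x i l * Gamma g l k j x = 1 / 2 *
      (pd k (fun y => g y i j) x + pd j (fun y => g y i k) x - pd i (fun y => g y k j) x) := by
  let w : Fin n → ℝ := fun m =>
    pd k (fun y => g y m j) x + pd j (fun y => g y m k) x - pd m (fun y => g y k j) x
  have h : (fun l => Gamma g l k j x) = (1 / 2 : ℝ) • ((g x)⁻¹ *ᵥ w) := by
    ext l
    simp [Gamma, Matrix.mulVec, dotProduct, w]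
  change (g x *ᵥ fun l => Gamma g l k j x) i = 1 / 2 * w i
  rw [h, Matrix.mulVec_smul, Matrix.mulVec_mulVec, Matrix.mul_nonsing_inv _ (hg.nondeg x hx)]
  simp

/-- Metric compatibility of the Levi-Civita connection. -/
theorem pd_metric_eq (hUo : IsOpen U) (hg : IsMetricOn U g) {x : Fin n → ℝ} (hx : x ∈ U)
    (k i j : Fin n) :
    pd k (fun y => g y i j) x
      = (∑ l, Gamma g l k i x * g x l j) + ∑ l, g x i l * Gamma g l k j x := by
  have h : ∑ l, Gamma g l k i x * g x l j = ∑ l, g x j l * Gamma g l k i x :=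
    Finset.sum_congr rfl fun l _ => by rw [(hg.symm x hx).apply j l, mul_comm]
  rw [h, sum_metric_mul_Gamma hg hx, sum_metric_mul_Gamma hg hx, pd_metric_symm hUo hg hx k j i,
    pd_metric_symm hUo hg hx j k i, pd_metric_symm hUo hg hx i k j]
  ring

/-- The connection matrix in the direction `v`. -/
noncomputable def connectionMatrix {n : ℕ} (g : (Fin n → ℝ) → Matrix (Fin n) (Fin n) ℝ) (x v : Fin n → ℝ) :
    Matrix (Fin n) (Fin n) ℝ :=
  Matrix.of fun k j => ∑ i, Gamma g k i j x * v i

theorem hasDerivAt_metric_comp (hUo : IsOpen U) (hg : IsMetricOn U g) {γ : ℝ → Fin n → ℝ}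
    {s : ℝ} {v : Fin n → ℝ} (hγ : HasDerivAt γ v s) (hs : γ s ∈ U) :
    HasDerivAt (fun r => g (γ r)) ((connectionMatrix g (γ s) v)ᵀ * g (γ s)
      + g (γ s) * connectionMatrix g (γ s) v) s := by
  refine hasDerivAt_matrix_iff.2 fun i j => ?_
  have hd : DifferentiableAt ℝ (fun y => g y i j) (γ s) :=
    ((hg.smooth i j).contDiffAt (hUo.mem_nhds hs)).differentiableAt (by simp)
  refine (hd.hasFDerivAt.comp_hasDerivAt s hγ).congr_deriv ?_
  have hv : v = ∑ k, v k • (Pi.single k 1 : Fin n → ℝ) := by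
    simpa using pi_eq_sum_univ' v
  conv_lhs => rw [hv, map_sum]
  have : ∀ k, fderiv ℝ (fun y => g y i j) (γ s) (v k • Pi.single k 1)
      = v k * ((∑ l, Gamma g l k i (γ s) * g (γ s) l j)
        + ∑ l, g (γ s) i l * Gamma g l k j (γ s)) := fun k => by
    rw [map_smul, ← pd_metric_eq hUo hg hs]
    rfl
  simp only [this, Matrix.add_apply, Matrix.mul_apply, Matrix.transpose_apply, connectionMatrix,
    Matrix.of_apply, mul_add, Finset.sum_add_distrib, Finset.mul_sum, Finset.sum_mul]
  congr 1
  · rw [Finset.sum_comm]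
    exact Finset.sum_congr rfl fun l _ => Finset.sum_congr rfl fun k _ => by ring
  · rw [Finset.sum_comm]
    exact Finset.sum_congr rfl fun l _ => Finset.sum_congr rfl fun k _ => by ring

end MetricAlongCurve

section Geodesics

open scoped ContDiff

variable {n : ℕ} {U : Set (Fin n → ℝ)} {g gbar : (Fin n → ℝ) → Matrix (Fin n) (Fin n) ℝ}

theorem contDiffOn_pd (hUo : IsOpen U) {f : (Fin n → ℝ) → ℝ} (hf : ContDiffOn ℝ ∞ f U)
    (i : Fin n) : ContDiffOn ℝ ∞ (pd i f) U :=
  (hf.fderiv_of_isOpen hUo le_rfl).clm_apply contDiffOn_const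

open scoped Matrix.Norms.Operator in
theorem contDiffOn_inv_metric (hg : IsMetricOn U g) (i j : Fin n) :
    ContDiffOn ℝ ∞ (fun x => (g x)⁻¹ i j) U := by
  have hgm : ContDiffOn ℝ ∞ g U := by
    rw [show g = fun x => ∑ i, ∑ j, g x i j • Matrix.single i j (1 : ℝ) from
      funext fun x => by simpa using Matrix.matrix_eq_sum_single (g x)]
    exact ContDiffOn.sum fun i _ => ContDiffOn.sum fun j _ =>
      (hg.smooth i j).smul contDiffOn_const
  have hdet : ContDiffOn ℝ ∞ (fun x => (g x).det) U := contDiff_matrix_det.comp_contDiffOn hgm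
  have hadj : ContDiffOn ℝ ∞ (fun x => (g x).adjugate i j) U :=
    ((contDiff_matrix_entry i j).comp contDiff_matrix_adjugate).comp_contDiffOn hgm
  simp only [Matrix.inv_def, Ring.inverse_eq_inv', Matrix.smul_apply, smul_eq_mul]
  exact (hdet.inv fun x hx => (hg.nondeg x hx).ne_zero).mul hadj

theorem contDiffOn_Gamma (hUo : IsOpen U) (hg : IsMetricOn U g) (k i j : Fin n) :
    ContDiffOn ℝ ∞ (Gamma g k i j) U :=
  contDiffOn_const.mul <| ContDiffOn.sum fun l _ => (contDiffOn_inv_metric hg k l).mul <|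
    ((contDiffOn_pd hUo (hg.smooth l j) i).add (contDiffOn_pd hUo (hg.smooth l i) j)).sub
      (contDiffOn_pd hUo (hg.smooth i j) l)

/-- Integral curves of a smooth vector field are smooth. -/
theorem contDiffOn_infty_of_hasDerivAt {E : Type*} [NormedAddCommGroup E] [NormedSpace ℝ E]
    {F : E → E} {V : Set E} (hF : ContDiffOn ℝ ∞ F V) {α : ℝ → E} {I : Set ℝ} (hI : IsOpen I)
    (hmem : ∀ t ∈ I, α t ∈ V) (hα : ∀ t ∈ I, HasDerivAt α (F (α t)) t) :
    ContDiffOn ℝ ∞ α I := by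
  have hdiff : DifferentiableOn ℝ α I := fun t ht =>
    (hα t ht).differentiableAt.differentiableWithinAt
  refine contDiffOn_infty.2 fun m => ?_
  induction m with
  | zero => exact contDiffOn_zero.2 hdiff.continuousOn
  | succ m ih =>
    push_cast
    refine (contDiffOn_succ_iff_deriv_of_isOpen hI).2 ⟨hdiff, by simp, ?_⟩
    exact ((hF.of_le (by exact_mod_cast le_top)).comp ih hmem).congr fun t ht => (hα t ht).deriv

/-- Local existence of geodesics with prescribed nonzero initial velocity. -/
theorem exists_geodesic (hUo : IsOpen U) (hg : IsMetricOn U g) {x v : Fin n → ℝ} (hx : x ∈ U)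
    (hv : v ≠ 0) :
    ∃ (γ : ℝ → Fin n → ℝ) (I : Set ℝ), IsGeodesicOn U g γ I ∧ 0 ∈ I ∧ γ 0 = x ∧
      (∀ k, deriv (fun s => γ s k) 0 = v k) ∧ ∀ t ∈ I, ∃ k, deriv (fun s => γ s k) t ≠ 0 := by
  let F : (Fin n → ℝ) × (Fin n → ℝ) → (Fin n → ℝ) × (Fin n → ℝ) := fun p =>
    (p.2, fun k => -∑ i, ∑ j, Gamma g k i j p.1 * p.2 i * p.2 j)
  let V : Set ((Fin n → ℝ) × (Fin n → ℝ)) := U ×ˢ {w | w ≠ 0}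
  have hVo : IsOpen V := hUo.prod isOpen_ne
  have hF : ContDiffOn ℝ ∞ F V := by
    refine contDiffOn_snd.prodMk (contDiffOn_pi.2 fun k => ?_)
    refine (ContDiffOn.sum fun i _ => ContDiffOn.sum fun j _ => ?_).neg
    have h1 : ContDiffOn ℝ ∞ (fun p : (Fin n → ℝ) × (Fin n → ℝ) => Gamma g k i j p.1) V :=
      (contDiffOn_Gamma hUo hg k i j).comp contDiffOn_fst fun p hp => hp.1
    have h2 : ∀ l, ContDiffOn ℝ ∞ (fun p : (Fin n → ℝ) × (Fin n → ℝ) => p.2 l) V := fun l =>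
      contDiffOn_pi.1 contDiffOn_snd l
    exact (h1.mul (h2 i)).mul (h2 j)
  have hxv : (x, v) ∈ V := ⟨hx, hv⟩
  obtain ⟨α, hα0, ε, hε, hα⟩ :=
    ((hF.contDiffAt (hVo.mem_nhds hxv)).of_le
      (by exact_mod_cast le_top)).exists_forall_mem_closedBall_exists_eq_forall_mem_Ioo_hasDerivAt₀ 0
  have hcont : ContinuousAt α 0 := (hα 0 (by simp [hε])).continuousAt
  obtain ⟨δ, hδ, hδV⟩ := Metric.eventually_nhds_iff_ball.1
    (hcont.eventually_mem (hα0 ▸ hVo.mem_nhds hxv))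
  let I : Set ℝ := Set.Ioo (-min ε δ) (min ε δ)
  have hI : IsOpen I := isOpen_Ioo
  have hmin : 0 < min ε δ := lt_min hε hδ
  have hder : ∀ t ∈ I, HasDerivAt α (F (α t)) t := fun t ht =>
    hα t ⟨by linarith [ht.1, min_le_left ε δ], by linarith [ht.2, min_le_left ε δ]⟩
  have hmem : ∀ t ∈ I, α t ∈ V := fun t ht => by
    refine hδV t ?_
    rw [Real.ball_eq_Ioo]
    exact ⟨by linarith [ht.1, min_le_right ε δ], by linarith [ht.2, min_le_right ε δ]⟩
  have hsm := contDiffOn_infty_of_hasDerivAt hF hI hmem hder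
  have hd1 : ∀ t ∈ I, ∀ k, deriv (fun s => (α s).1 k) t = (α t).2 k := fun t ht k =>
    (hasDerivAt_pi.1 (hder t ht).fst k).deriv
  have h0 : (0 : ℝ) ∈ I := by simp [I, hε, hδ]
  refine ⟨fun t => (α t).1, I, ⟨⟨hI, Set.ordConnected_Ioo⟩, fun k => ?_, fun t ht => (hmem t ht).1,
    fun t ht k => ?_⟩, h0, by simp [hα0], fun k => ?_, fun t ht => ?_⟩
  · exact contDiffOn_pi.1 hsm.fst k
  · have : deriv (fun s => (α s).1 k) =ᶠ[nhds t] fun s => (α s).2 k := by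
      filter_upwards [hI.mem_nhds ht] with s hs using hd1 s hs k
    rw [this.deriv_eq, (hasDerivAt_pi.1 (hder t ht).snd k).deriv]
    simp only [hd1 t ht, F]
    ring
  · rw [hd1 0 h0, hα0]
  · obtain ⟨k, hk⟩ := Function.ne_iff.1 (hmem t ht).2
    exact ⟨k, by simpa [hd1 t ht] using hk⟩

/-- For projectively equivalent metrics the difference of the Christoffel symbols maps `(v, v)` to
a multiple of `v`. -/
theorem exists_smul_eq_Gamma_sub (hUo : IsOpen U) (hg : IsMetricOn U g)
    (hproj : ProjEquiv U g gbar) {x : Fin n → ℝ} (hx : x ∈ U) (v : Fin n → ℝ) :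
    ∃ c : ℝ, ∀ k, ∑ i, ∑ j, (Gamma gbar k i j x - Gamma g k i j x) * v i * v j = c * v k := by
  by_cases hv : v = 0
  · exact ⟨0, fun k => by simp [hv]⟩
  obtain ⟨γ, I, hγ, h0, hγ0, hγv, hne⟩ := exists_geodesic hUo hg hx hv
  obtain ⟨φ, J, hJ, hφ, -, hφJ, hφ', hγφ⟩ := hproj γ I hγ hne
  obtain ⟨s, hs, hφs⟩ : (0 : ℝ) ∈ φ '' J := hφJ ▸ h0
  have hIJ : ∀ r ∈ J, φ r ∈ I := fun r hr => hφJ ▸ Set.mem_image_of_mem φ hr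
  have hφd : ∀ r ∈ J, HasDerivAt φ (deriv φ r) r := fun r hr =>
    ((hφ.contDiffAt (hJ.1.mem_nhds hr)).differentiableAt (by simp)).hasDerivAt
  have hγd : ∀ k, ∀ t ∈ I, HasDerivAt (fun s => γ s k) (deriv (fun s => γ s k) t) t :=
    fun k t ht => (((hγ.smooth k).contDiffAt
      (hγ.interval.1.mem_nhds ht)).differentiableAt (by simp)).hasDerivAt
  have hd1 : ∀ k, ∀ r ∈ J, deriv (fun s => (γ ∘ φ) s k) r
      = deriv (fun s => γ s k) (φ r) * deriv φ r := fun k r hr =>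
    ((hγd k _ (hIJ r hr)).comp r (hφd r hr)).deriv
  have hφdd : HasDerivAt (deriv φ) (deriv (deriv φ) s) s :=
    ((((contDiffOn_infty_iff_deriv_of_isOpen hJ.1).1 hφ).2.contDiffAt
      (hJ.1.mem_nhds hs)).differentiableAt (by simp)).hasDerivAt
  have hγdd : ∀ k, HasDerivAt (deriv fun s => γ s k) (deriv (deriv fun s => γ s k) (φ s)) (φ s) :=
    fun k => ((((contDiffOn_infty_iff_deriv_of_isOpen hγ.interval.1).1 (hγ.smooth k)).2.contDiffAt
      (hγ.interval.1.mem_nhds (hIJ s hs))).differentiableAt (by simp)).hasDerivAt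
  have hd2 : ∀ k, deriv (deriv fun s => (γ ∘ φ) s k) s
      = deriv (deriv fun s => γ s k) 0 * deriv φ s * deriv φ s + v k * deriv (deriv φ) s := by
    intro k
    have : (deriv fun s => (γ ∘ φ) s k) =ᶠ[nhds s]
        fun r => deriv (fun s => γ s k) (φ r) * deriv φ r := by
      filter_upwards [hJ.1.mem_nhds hs] with r hr using hd1 k r hr
    rw [this.deriv_eq, ← hγv k, ← hφs]
    exact (((hγdd k).comp s (hφd s hs)).mul hφdd).deriv
  have hp := hφ' s hs
  refine ⟨-deriv (deriv φ) s / deriv φ s ^ 2, fun k => ?_⟩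
  have e1 := hγφ.eqn s hs k
  have e2 := hγ.eqn 0 h0 k
  rw [hd2] at e1
  simp only [hd1 _ s hs] at e1
  simp only [Function.comp_apply, hφs, hγ0, hγv] at e1 e2
  have e3 : ∑ i, ∑ j, Gamma gbar k i j x * (v i * deriv φ s) * (v j * deriv φ s)
      = (∑ i, ∑ j, Gamma gbar k i j x * v i * v j) * deriv φ s ^ 2 := by
    simp only [Finset.sum_mul]
    exact Finset.sum_congr rfl fun i _ => Finset.sum_congr rfl fun j _ => by ring
  rw [e3] at e1
  simp only [sub_mul, Finset.sum_sub_distrib]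
  field_simp
  linear_combination e1 - deriv φ s ^ 2 * e2

/-- The connections of projectively equivalent metrics differ by a covector. -/
theorem exists_covector_connectionMatrix (hUo : IsOpen U) (hg : IsMetricOn U g)
    (hgbar : IsMetricOn U gbar) (hproj : ProjEquiv U g gbar) {x : Fin n → ℝ} (hx : x ∈ U) :
    ∃ φ : Fin n → ℝ, ∀ v, connectionMatrix gbar x v
      = connectionMatrix g x v + vecMulVec v φ + (φ ⬝ᵥ v) • 1 := by
  obtain ⟨φ, hφ⟩ := exists_covector_of_quadratic_proportional
    (T := fun k i j => Gamma gbar k i j x - Gamma g k i j x)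
    (fun k i j => by rw [Gamma_symm hUo hg hx, Gamma_symm hUo hgbar hx])
    (exists_smul_eq_Gamma_sub hUo hg hproj hx)
  refine ⟨φ, fun v => ?_⟩
  ext k j
  have h : ∀ i, Gamma gbar k i j x * v i = Gamma g k i j x * v i
      + ((if k = i then φ j * v i else 0) + (if k = j then φ i * v i else 0)) := fun i => by
    rw [← sub_eq_iff_eq_add', ← sub_mul, hφ, add_mul, ite_mul, ite_mul, zero_mul]
  simp only [connectionMatrix, Matrix.of_apply, h, Finset.sum_add_distrib, Matrix.add_apply,
    Matrix.vecMulVec_apply, Matrix.smul_apply, Matrix.one_apply, dotProduct, smul_eq_mul]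
  split_ifs <;> simp <;> ring

end Geodesics

open scoped Matrix.Norms.Operator in
/-- The derivative of the quadratic form of `g S(t)` along a `g`-geodesic vanishes. -/
theorem hasDerivAt_killing_form {n : ℕ} {U : Set (Fin n → ℝ)}
    {g gbar : (Fin n → ℝ) → Matrix (Fin n) (Fin n) ℝ} (hUo : IsOpen U) (hg : IsMetricOn U g)
    (hgbar : IsMetricOn U gbar) (hproj : ProjEquiv U g gbar) (t : ℝ) {γ : ℝ → Fin n → ℝ}
    {I : Set ℝ} (hγ : IsGeodesicOn U g γ I) {s : ℝ} (hs : s ∈ I) :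
    HasDerivAt (fun r => ∑ i, ∑ j, deriv (fun s => γ s i) r
      * (g (γ r) * Sfield g gbar t (γ r)) i j * deriv (fun s => γ s j) r) 0 s := by
  let v : ℝ → Fin n → ℝ := fun r k => deriv (fun s => γ s k) r
  let C := connectionMatrix g (γ s) (v s)
  have hI := hγ.interval.1
  have hx := hγ.mem s hs
  have hγd : HasDerivAt γ (v s) s := hasDerivAt_pi.2 fun k =>
    (((hγ.smooth k).contDiffAt (hI.mem_nhds hs)).differentiableAt (by simp)).hasDerivAt
  have hv : HasDerivAt v (-(C *ᵥ v s)) s := by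
    refine hasDerivAt_pi.2 fun k => ?_
    have h := ((((contDiffOn_infty_iff_deriv_of_isOpen hI).1 (hγ.smooth k)).2.contDiffAt
      (hI.mem_nhds hs)).differentiableAt (by simp)).hasDerivAt
    refine h.congr_deriv ?_
    rw [eq_neg_of_add_eq_zero_left (hγ.eqn s hs k), Finset.sum_comm]
    simp [C, connectionMatrix, Matrix.mulVec, dotProduct, Finset.sum_mul, v]
  obtain ⟨φ, hφ⟩ := exists_covector_connectionMatrix hUo hg hgbar hproj hx
  have hG := hasDerivAt_metric_comp hUo hg hγd hx
  have hH := hasDerivAt_metric_comp hUo hgbar hγd hx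
  rw [hφ] at hH
  have hL := hasDerivAt_normalized_inv_mul (L := fun r => Lfield g gbar (γ r)) (fun r => rfl) hG hH
    (hg.nondeg _ hx) (hgbar.nondeg _ hx)
  have ha : HasDerivAt (fun r => v r ᵥ* g (γ r)) ((v s ᵥ* g (γ s)) ᵥ* C) s := by
    refine hasDerivAt_pi.2 fun j => ?_
    have h := hasDerivAt_bilinear hv hG (hasDerivAt_const s (Pi.single j (1 : ℝ)))
    have h2 : ∀ (w : Fin n → ℝ) (B : Matrix (Fin n) (Fin n) ℝ),
        w ⬝ᵥ B *ᵥ Pi.single j 1 = (w ᵥ* B) j := fun w B => by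
      rw [Matrix.dotProduct_mulVec, dotProduct_single_one]
    simp only [h2] at h
    refine h.congr_deriv ?_
    rw [Matrix.vecMul_add, ← Matrix.vecMul_vecMul, ← Matrix.vecMul_vecMul, Matrix.vecMul_transpose,
      Matrix.neg_vecMul]
    simp [C]
  refine (hasDerivAt_adjugate_form ha hv hL t).congr_of_eventuallyEq (Filter.Eventually.of_forall
    fun r => ?_)
  change _ = (v r ᵥ* g (γ r)) ⬝ᵥ Sfield g gbar t (γ r) *ᵥ v r
  rw [← Matrix.dotProduct_mulVec, Matrix.mulVec_mulVec]
  simp only [dotProduct, Matrix.mulVec, Finset.mul_sum, v, mul_assoc]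

theorem gS_is_Killing_tensor {n : ℕ} (hn : 2 ≤ n) (U : Set (Fin n → ℝ)) (hUo : IsOpen U) (hUc : IsConnected U)
    (g gbar : (Fin n → ℝ) → Matrix (Fin n) (Fin n) ℝ)
    (hg : IsMetricOn U g) (hgbar : IsMetricOn U gbar)
    (hproj : ProjEquiv U g gbar) (t : ℝ) :
    IsKillingTensorOn U g (fun x => g x * Sfield g gbar t x) := by
  intro γ I hγ τ₁ h₁ τ₂ h₂
  have hd := fun s hs => hasDerivAt_killing_form hUo hg hgbar hproj t hγ (s := s) hs
  exact hγ.interval.1.is_const_of_deriv_eq_zero hγ.interval.2.isPreconnected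
    (fun s hs => (hd s hs).differentiableAt.differentiableWithinAt) (fun s hs => (hd s hs).deriv)
    h₁ h₂
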